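/- arXiv:2411.11610 — 9 statements merged into one kernel-verified Lean document; each statement's English description precedes it below -/
import Mathlib

section
/- Let S, D ⊆ ℝⁿ be compact and non-empty sets with S ⊆ D and D \ S non-empty, and let γ : ℝⁿ → ℝ be continuous on D \ S with γ(x) > 0 for all x ∈ D \ S. Set r̄ := max_{x ∈ D} ‖x‖_S. Then there exists a class K function α : [0, r̄] → ℝ such that γ(x) ≥ α(‖x‖_S) for all x ∈ D \ S. -/
/-- A function `α` is of class `𝒦` on `[0, r]`: continuous, strictly increasing, `α 0 = 0`. -/
def IsClassKOn (α : ℝ → ℝ) (r : ℝ) : Prop :=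
  ContinuousOn α (Set.Icc 0 r) ∧ StrictMonoOn α (Set.Icc 0 r) ∧ α 0 = 0

/-- Lemma 1 (class-`𝒦` lower bound): for compact nonempty `S ⊆ D` with `D \ S` nonempty and
`γ` continuous and positive on `D \ S`, there is a class-`𝒦` function `α` on
`[0, r̄]` with `r̄ = max_{x ∈ D} ‖x‖_S` such that `γ x ≥ α (‖x‖_S)` on `D \ S`. -/
theorem stmt0 {n : ℕ} (S D : Set (EuclideanSpace ℝ (Fin n)))
    (hScomp : IsCompact S) (hSne : S.Nonempty)
    (hDcomp : IsCompact D) (hDne : D.Nonempty)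
    (hSD : S ⊆ D) (hDSne : (D \ S).Nonempty)
    (γ : EuclideanSpace ℝ (Fin n) → ℝ)
    (hγc : ContinuousOn γ (D \ S))
    (hγpos : ∀ x ∈ D \ S, 0 < γ x) :
    ∃ α : ℝ → ℝ,
      IsClassKOn α (sSup ((fun x => Metric.infDist x S) '' D)) ∧
      ∀ x ∈ D \ S, α (Metric.infDist x S) ≤ γ x := by
  classical
  haveI : Nonempty ↥(D \ S) := hDSne.to_subtype
  let d : EuclideanSpace ℝ (Fin n) → ℝ := fun x => Metric.infDist x S
  have hdc : Continuous d := Metric.continuous_infDist_pt S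
  let h : ℝ → ℝ := fun s => ⨅ x : ↥(D \ S), (γ x + max (s - d x) 0)
  have hbdd : ∀ s, BddBelow (Set.range fun x : ↥(D \ S) => γ x + max (s - d x) 0) := by
    intro s
    refine ⟨0, ?_⟩
    rintro _ ⟨x, rfl⟩
    have := hγpos x x.2
    have := le_max_right (s - d x) 0
    dsimp only
    linarith
  have hle : ∀ s (x : ↥(D \ S)), h s ≤ γ x + max (s - d x) 0 := fun s x => ciInf_le (hbdd s) x
  have hmono : Monotone h := by
    intro s t hst
    refine le_ciInf fun x => (hle s x).trans ?_
    gcongr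
  have hlip : LipschitzWith 1 h := by
    refine LipschitzWith.of_le_add fun s t => ?_
    rw [← sub_le_iff_le_add]
    refine le_ciInf fun x => ?_
    have h1 := hle s x
    have h2 : max (s - d x) 0 ≤ max (t - d x) 0 + dist s t := by
      have h3 : s - t ≤ dist s t := by rw [Real.dist_eq]; exact le_abs_self _
      have h4 : 0 ≤ dist s t := dist_nonneg
      apply max_le
      · linarith [le_max_left (t - d x) 0]
      · linarith [le_max_right (t - d x) 0]
    linarith
  have hpos : ∀ s, 0 < s → 0 < h s := by
    intro s hs
    have hKc : IsCompact (D ∩ {x | s / 2 ≤ d x}) :=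
      hDcomp.inter_right (isClosed_le continuous_const hdc)
    have hKsub : D ∩ {x | s / 2 ≤ d x} ⊆ D \ S := by
      rintro x ⟨hxD, hx⟩
      refine ⟨hxD, fun hxS => ?_⟩
      have h0 : d x = 0 := Metric.infDist_zero_of_mem hxS
      have hx' : s / 2 ≤ d x := hx
      linarith
    obtain ⟨c, hc, hcK⟩ : ∃ c, 0 < c ∧ ∀ x ∈ D ∩ {x | s / 2 ≤ d x}, c ≤ γ x := by
      rcases (D ∩ {x | s / 2 ≤ d x}).eq_empty_or_nonempty with he | hne
      · exact ⟨1, one_pos, by simp [he]⟩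
      · obtain ⟨x0, hx0, hmin⟩ := hKc.exists_isMinOn hne (hγc.mono hKsub)
        exact ⟨γ x0, hγpos x0 (hKsub hx0), fun x hx => hmin hx⟩
    have : min c (s / 2) ≤ h s := by
      refine le_ciInf fun x => ?_
      have hg := hγpos x x.2
      by_cases hx : s / 2 ≤ d x
      · have h1 := hcK x ⟨x.2.1, hx⟩
        linarith [min_le_left c (s / 2), le_max_right (s - d x) 0]
      · linarith [min_le_right c (s / 2), le_max_left (s - d x) 0]
    exact lt_of_lt_of_le (lt_min hc (by linarith)) this
  have hnn : ∀ s, 0 ≤ h s := by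
    intro s
    refine le_ciInf fun x => ?_
    linarith [hγpos x x.2, le_max_right (s - d x) 0]
  refine ⟨fun s => h s * (s / (s + 1)), ⟨?_, ?_, by simp⟩, ?_⟩
  · refine hlip.continuous.continuousOn.mul (continuousOn_id.div (by fun_prop) ?_)
    intro s hs
    have := hs.1
    positivity
  · intro s hs t ht hst
    have hs0 := hs.1
    have ht0 : 0 < t := lt_of_le_of_lt hs0 hst
    have hf : s / (s + 1) < t / (t + 1) := by
      rw [div_lt_div_iff₀ (by linarith) (by linarith)]
      nlinarith
    have hf0 : 0 ≤ s / (s + 1) := by positivity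
    calc h s * (s / (s + 1)) ≤ h t * (s / (s + 1)) :=
          mul_le_mul_of_nonneg_right (hmono hst.le) hf0
      _ < h t * (t / (t + 1)) := mul_lt_mul_of_pos_left hf (hpos t ht0)
  · intro x hx
    have h1 := hle (d x) ⟨x, hx⟩
    simp only [sub_self, max_self, add_zero] at h1
    have h0 : 0 ≤ d x := Metric.infDist_nonneg
    have h2 : d x / (d x + 1) ≤ 1 := by
      rw [div_le_one (by linarith)]
      linarith
    exact (mul_le_of_le_one_right (hnn _) h2).trans h1
end

section
/- Let r̄ > 0 and let p : (0, r̄] → ℝ be non-decreasing with p(r) > 0 for every r ∈ (0, r̄]. Then there exists a class K function α : [0, r̄] → ℝ such that α(r) ≤ p(r) for all r ∈ (0, r̄]. -/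
/-- A non-decreasing positive function `p` on `(0, rbar]` admits a class-`𝒦` lower bound. -/
theorem stmt1 (rbar : ℝ) (hr : 0 < rbar) (p : ℝ → ℝ)
    (hmono : MonotoneOn p (Set.Ioc 0 rbar))
    (hpos : ∀ r ∈ Set.Ioc 0 rbar, 0 < p r) :
    ∃ α : ℝ → ℝ, IsClassKOn α rbar ∧ ∀ r ∈ Set.Ioc 0 rbar, α r ≤ p r := by
  classical
  let q : ℝ → ℝ := fun x => if x ≤ 0 then 0 else p (min x rbar)
  have hmem : ∀ x, 0 < x → min x rbar ∈ Set.Ioc 0 rbar := fun x hx =>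
    ⟨lt_min hx hr, min_le_right _ _⟩
  have hq : Monotone q := by
    intro x y hxy
    simp only [q]
    split_ifs with h1 h2 h2
    · exact le_rfl
    · exact (hpos _ (hmem y (not_le.1 h2))).le
    · exact absurd (hxy.trans h2) h1
    · exact hmono (hmem x (not_le.1 h1)) (hmem y (not_le.1 h2)) (min_le_min_right _ hxy)
  have hqpos : ∀ x, 0 < x → 0 < q x := by
    intro x hx
    simp only [q, if_neg (not_le.2 hx)]
    exact hpos _ (hmem x hx)
  have hqp : ∀ x ∈ Set.Ioc 0 rbar, q x = p x := by
    intro x hx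
    simp only [q, if_neg (not_le.2 hx.1), min_eq_left hx.2]
  have hint : ∀ a b, IntervalIntegrable q MeasureTheory.volume a b := fun a b =>
    hq.intervalIntegrable
  refine ⟨fun r => (∫ x in (0:ℝ)..r, q x) / rbar, ⟨?_, ?_, by simp⟩, ?_⟩
  · exact ((intervalIntegral.continuous_primitive hint 0).div_const rbar).continuousOn
  · intro a ha b hb hab
    have h1 : 0 < ∫ x in a..b, q x :=
      intervalIntegral.intervalIntegral_pos_of_pos_on (hint a b)
        (fun x hx => hqpos x (ha.1.trans_lt hx.1)) hab
    have h2 := intervalIntegral.integral_add_adjacent_intervals (hint 0 a) (hint a b)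
    exact div_lt_div_of_pos_right (by linarith) hr
  · intro r hrr
    have h1 : (∫ x in (0:ℝ)..r, q x) ≤ ∫ x in (0:ℝ)..r, p r := by
      apply intervalIntegral.integral_mono_on hrr.1.le (hint 0 r) (by simp)
      intro x hx
      rw [← hqp r hrr]
      exact hq hx.2
    rw [intervalIntegral.integral_const, smul_eq_mul, sub_zero] at h1
    have h3 := mul_le_mul_of_nonneg_right hrr.2 (hpos r hrr).le
    show (∫ x in (0:ℝ)..r, q x) / rbar ≤ p r
    rw [div_le_iff₀ hr]
    linarith
end

section
/- Let S, D ⊆ ℝⁿ be compact and non-empty sets with S ⊆ D, and let γ : ℝⁿ → ℝ be continuous on D \ int(S) with γ(x) > 0 for all x ∈ D \ S and γ(x) = 0 for all x in the topological boundary ∂S of S. Set r̄ := max_{x ∈ D} ‖x‖_S and assume r̄ > 0. Then there exists a class K function β : [0, r̄] → ℝ such that γ(x) ≤ β(‖x‖_S) for all x ∈ D \ int(S). -/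
lemma classK_env (A : Set (ℝ × ℝ)) (hA : ∀ p ∈ A, 0 ≤ p.1 ∧ 0 ≤ p.2)
    (hε : ∀ ε > 0, ∃ L, (ε, L) ∈ A) (r : ℝ) :
    ∃ β : ℝ → ℝ, IsClassKOn β r ∧
      ∀ y s, 0 ≤ s → (∀ p ∈ A, y ≤ p.1 + p.2 * s) → y ≤ β s := by
  obtain ⟨L1, hL1⟩ := hε 1 one_pos
  have : Nonempty A := ⟨⟨_, hL1⟩⟩
  let g : ℝ → ℝ := fun s => ⨅ p : A, (p.1.1 + p.1.2 * s)
  have hbdd : ∀ s, 0 ≤ s → BddBelow (Set.range fun p : A => p.1.1 + p.1.2 * s) := by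
    intro s hs
    refine ⟨0, ?_⟩
    rintro _ ⟨p, rfl⟩
    have := hA p.1 p.2
    have := mul_nonneg this.2 hs
    dsimp only
    linarith
  have hle : ∀ s, 0 ≤ s → ∀ p ∈ A, g s ≤ p.1 + p.2 * s := fun s hs p hp =>
    ciInf_le (hbdd s hs) (⟨p, hp⟩ : A)
  have hge : ∀ y s, (∀ p ∈ A, y ≤ p.1 + p.2 * s) → y ≤ g s := fun y s h =>
    le_ciInf fun p => h p.1 p.2
  have hcont : ∀ ε L, (ε, L) ∈ A → ∀ s t, 0 ≤ s → 0 ≤ t → g s - (ε + L * |s - t|) ≤ g t := by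
    intro ε L hL s t hs ht
    apply hge
    intro p hp
    have h1 := hA p hp
    have h2 := hA _ hL
    dsimp only at h2
    have h3 := le_abs_self (s - t)
    rcases le_total p.2 L with h | h
    · have := hle s hs p hp
      nlinarith [mul_nonneg (sub_nonneg.2 h) (abs_nonneg (s - t)),
        mul_nonneg h1.2 (sub_nonneg.2 h3)]
    · have := hle s hs _ hL
      dsimp only at this
      nlinarith [mul_nonneg (sub_nonneg.2 h) ht, mul_nonneg h2.2 (sub_nonneg.2 h3)]
  have hmono : ∀ s t, 0 ≤ s → s ≤ t → g s ≤ g t := by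
    intro s t hs hst
    apply hge
    intro p hp
    have := hle s hs p hp
    nlinarith [mul_nonneg (hA p hp).2 (sub_nonneg.2 hst)]
  have hg0 : g 0 = 0 := by
    apply le_antisymm
    · apply le_of_forall_pos_le_add
      intro ε he
      obtain ⟨L, hL⟩ := hε ε he
      simpa using hle 0 le_rfl _ hL
    · apply hge
      intro p hp
      simpa using (hA p hp).1
  have hgc : ContinuousOn g (Set.Icc 0 r) := by
    rw [Metric.continuousOn_iff]
    intro t ht e he
    obtain ⟨L, hL⟩ := hε (e / 2) (half_pos he)
    have hL0 : 0 ≤ L := (hA _ hL).2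
    refine ⟨e / (2 * (L + 1)), by positivity, ?_⟩
    intro s hs hd
    rw [Real.dist_eq] at hd ⊢
    rw [lt_div_iff₀ (by positivity)] at hd
    have h1 := hcont _ _ hL s t hs.1 ht.1
    have h2 := hcont _ _ hL t s ht.1 hs.1
    rw [abs_sub_comm t s] at h2
    have h0 := abs_nonneg (s - t)
    rcases h0.eq_or_lt with h | h
    · have : s = t := by
        have := abs_eq_zero.1 h.symm
        linarith
      subst this
      simpa using he
    rw [abs_lt]
    constructor <;> nlinarith
  refine ⟨fun s => g s + s, ⟨hgc.add continuousOn_id, ?_, by simp [hg0]⟩, ?_⟩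
  · intro s hs t ht hst
    have := hmono s t hs.1 hst.le
    dsimp only
    linarith
  · intro y s hs h
    have := hge y s h
    dsimp only
    linarith

/-- Lemma 2 (class-`𝒦` upper bound): for compact nonempty `S ⊆ D` and `γ` continuous on
`D \ int S`, positive on `D \ S` and zero on `∂S`, with `rbar = max_{x ∈ D} ‖x‖_S > 0`,
there is a class-`𝒦` function `β` on `[0, rbar]` with `γ x ≤ β (‖x‖_S)` on `D \ int S`. -/
theorem stmt2 {n : ℕ} (S D : Set (EuclideanSpace ℝ (Fin n)))
    (hScomp : IsCompact S) (hSne : S.Nonempty)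
    (hDcomp : IsCompact D) (hDne : D.Nonempty)
    (hSD : S ⊆ D)
    (γ : EuclideanSpace ℝ (Fin n) → ℝ)
    (hγc : ContinuousOn γ (D \ interior S))
    (hγpos : ∀ x ∈ D \ S, 0 < γ x)
    (hγzero : ∀ x ∈ frontier S, γ x = 0)
    (hrpos : 0 < sSup ((fun x => Metric.infDist x S) '' D)) :
    ∃ β : ℝ → ℝ,
      IsClassKOn β (sSup ((fun x => Metric.infDist x S) '' D)) ∧
      ∀ x ∈ D \ interior S, γ x ≤ β (Metric.infDist x S) := by
  set K := D \ interior S with hK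
  have hKc : IsCompact K := hDcomp.diff isOpen_interior
  suffices key : ∀ ε > 0, ∃ L, (ε, L) ∈
      {p : ℝ × ℝ | (0 ≤ p.1 ∧ 0 ≤ p.2) ∧ ∀ x ∈ K, γ x ≤ p.1 + p.2 * Metric.infDist x S} by
    obtain ⟨β, h1, h2⟩ := classK_env _ (fun p hp => hp.1) key
      (sSup ((fun x => Metric.infDist x S) '' D))
    exact ⟨β, h1, fun x hx => h2 _ _ Metric.infDist_nonneg fun p hp => hp.2 x hx⟩
  intro ε he
  obtain ⟨M, hM⟩ := hKc.bddAbove_image hγc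
  have hM' : ∀ x ∈ K, γ x ≤ M := fun x hx => hM ⟨x, hx, rfl⟩
  have hcl : IsClosed (K ∩ γ ⁻¹' Set.Ici ε) :=
    hγc.preimage_isClosed_of_isClosed hKc.isClosed isClosed_Ici
  have hC : IsCompact (K ∩ γ ⁻¹' Set.Ici ε) := hKc.of_isClosed_subset hcl Set.inter_subset_left
  rcases (K ∩ γ ⁻¹' Set.Ici ε).eq_empty_or_nonempty with hem | hne
  · refine ⟨0, ⟨he.le, le_rfl⟩, fun x hx => ?_⟩
    by_contra hcon
    have : x ∈ K ∩ γ ⁻¹' Set.Ici ε := ⟨hx, by simp at hcon ⊢; exact hcon.le⟩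
    rw [hem] at this
    exact this
  · obtain ⟨z, hz, hmin⟩ := hC.exists_isMinOn hne (Metric.continuous_infDist_pt S).continuousOn
    have hzS : z ∉ S := by
      intro h
      have h0 := hγzero z ⟨subset_closure h, hz.1.2⟩
      have : ε ≤ γ z := hz.2
      linarith
    have hd : 0 < Metric.infDist z S :=
      (hScomp.isClosed.notMem_iff_infDist_pos hSne).1 hzS
    have hzM := hM' z hz.1
    have hze : ε ≤ γ z := hz.2
    have hM0 : 0 ≤ M := by linarith
    refine ⟨M / Metric.infDist z S, ⟨he.le, by positivity⟩, fun x hx => ?_⟩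
    dsimp only
    by_cases hxe : ε ≤ γ x
    · have hm : Metric.infDist z S ≤ Metric.infDist x S := hmin ⟨hx, hxe⟩
      have := hM' x hx
      have h3 : M ≤ M / Metric.infDist z S * Metric.infDist x S := by
        rw [div_mul_eq_mul_div, le_div_iff₀ hd]
        exact mul_le_mul_of_nonneg_left hm hM0
      linarith
    · have : 0 ≤ M / Metric.infDist z S * Metric.infDist x S :=
        mul_nonneg (by positivity) Metric.infDist_nonneg
      linarith
end

section
/- Let r̄ > 0 and let q : [0, r̄] → ℝ be non-decreasing with q(r) ≥ 0 for all r ∈ [0, r̄] and with q(r) → 0 as r → 0⁺ (i.e., inf_{r ∈ (0, r̄]} q(r) = 0). Then there exists a class K function β : [0, r̄] → ℝ such that q(r) ≤ β(r) for all r ∈ (0, r̄]. -/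
/-- A non-decreasing, non-negative function `q` on `[0, rbar]` with
`inf_{r ∈ (0, rbar]} q r = 0` admits a class-`𝒦` upper bound on `(0, rbar]`. -/
theorem stmt3 (rbar : ℝ) (hr : 0 < rbar) (q : ℝ → ℝ)
    (hmono : MonotoneOn q (Set.Icc 0 rbar))
    (hnonneg : ∀ r ∈ Set.Icc 0 rbar, 0 ≤ q r)
    (hinf : sInf (q '' Set.Ioc 0 rbar) = 0) :
    ∃ β : ℝ → ℝ, IsClassKOn β rbar ∧ ∀ r ∈ Set.Ioc 0 rbar, q r ≤ β r := by
  classical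
  have hq0 : ∀ s ∈ Set.Ioc 0 rbar, 0 ≤ q s := fun s hs => hnonneg s ⟨hs.1.le, hs.2⟩
  have hqr : ∀ s ∈ Set.Ioc 0 rbar, q s ≤ q rbar := fun s hs =>
    hmono ⟨hs.1.le, hs.2⟩ ⟨hr.le, le_rfl⟩ hs.2
  have hR : rbar ∈ Set.Ioc 0 rbar := ⟨hr, le_rfl⟩
  obtain ⟨g, hg⟩ : ∃ g : ℝ → ℝ, ∀ r, g r =
    sSup ((fun s => q s * min 1 (r / s)) '' Set.Ioc 0 rbar) := ⟨_, fun _ => rfl⟩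
  have hle : ∀ r, ∀ s ∈ Set.Ioc 0 rbar, q s * min 1 (r / s) ≤ g r := by
    intro r s hs
    rw [hg]
    refine le_csSup ⟨q rbar, ?_⟩ ⟨s, hs, rfl⟩
    rintro _ ⟨t, ht, rfl⟩
    have h1 := hq0 t ht
    have h2 := hqr t ht
    have h3 : min 1 (r / t) ≤ 1 := min_le_left _ _
    show q t * min 1 (r / t) ≤ q rbar
    nlinarith
  have hge : ∀ r B, (∀ s ∈ Set.Ioc 0 rbar, q s * min 1 (r / s) ≤ B) → g r ≤ B := by
    intro r B h
    rw [hg]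
    refine csSup_le ⟨_, rbar, hR, rfl⟩ ?_
    rintro _ ⟨t, ht, rfl⟩
    exact h t ht
  have hgmono : Monotone g := by
    intro a b hab
    refine hge _ _ fun s hs => le_trans ?_ (hle b s hs)
    have h0 := hq0 s hs
    have h1 := hs.1
    gcongr
  have hg0 : g 0 = 0 := by
    apply le_antisymm
    · exact hge _ _ fun s hs => by simp
    · simpa using hle 0 rbar hR
  have hscale : ∀ a b, 0 < a → a ≤ b → g b ≤ b / a * g a := by
    intro a b ha hab
    refine hge _ _ fun s hs => ?_
    have h0 := hq0 s hs
    have h1 := hs.1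
    have h2 : 1 ≤ b / a := (one_le_div ha).2 hab
    have h3 : min 1 (b / s) ≤ b / a * min 1 (a / s) := by
      rw [mul_min_of_nonneg _ _ (by linarith)]
      apply min_le_min
      · linarith
      · apply le_of_eq; field_simp
    calc q s * min 1 (b / s) ≤ q s * (b / a * min 1 (a / s)) := by gcongr
      _ = b / a * (q s * min 1 (a / s)) := by ring
      _ ≤ _ := mul_le_mul_of_nonneg_left (hle a s hs) (by linarith)
  have hcont : ContinuousOn g (Set.Icc 0 rbar) := by
    intro x hx
    rcases hx.1.eq_or_lt with h | hx0
    · subst h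
      rw [Metric.continuousWithinAt_iff]
      intro ε hε
      obtain ⟨_, ⟨d, hd, rfl⟩, hdε⟩ : ∃ y ∈ q '' Set.Ioc 0 rbar, y < ε / 2 :=
        exists_lt_of_csInf_lt ⟨_, rbar, hR, rfl⟩ (by rw [hinf]; linarith)
      have hQ := hq0 rbar hR
      have hdp := hd.1
      refine ⟨ε / 2 * d / (q rbar + 1), by positivity, ?_⟩
      intro r hr' hdist
      rw [Real.dist_eq, sub_zero, abs_of_nonneg hr'.1, lt_div_iff₀ (by linarith)] at hdist
      have hgr : 0 ≤ g r := hg0 ▸ hgmono hr'.1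
      rw [hg0, Real.dist_eq, sub_zero, abs_of_nonneg hgr]
      have hrd : 0 ≤ r / d := div_nonneg hr'.1 hdp.le
      have h2 : q rbar * (r / d) < ε / 2 := by
        rw [← mul_div_assoc, div_lt_iff₀ hdp]
        nlinarith [hr'.1]
      have hb : g r ≤ q d + q rbar * (r / d) := by
        refine hge _ _ fun s hs => ?_
        have hs0 := hq0 s hs
        rcases le_total s d with hsd | hsd
        · have h3 := hmono ⟨hs.1.le, hs.2⟩ ⟨hd.1.le, hd.2⟩ hsd
          have h4 : min 1 (r / s) ≤ 1 := min_le_left _ _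
          have := mul_nonneg hQ hrd
          nlinarith
        · have h4 : min 1 (r / s) ≤ r / d :=
            (min_le_right _ _).trans (div_le_div_of_nonneg_left hr'.1 hdp hsd)
          have h5 := hqr s hs
          have h6 := hq0 d hd
          have : q s * min 1 (r / s) ≤ q rbar * (r / d) :=
            (mul_le_mul_of_nonneg_left h4 hs0).trans (mul_le_mul_of_nonneg_right h5 hrd)
          linarith
      linarith
    · apply ContinuousAt.continuousWithinAt
      have hgx : 0 ≤ g x := hg0 ▸ hgmono hx0.le
      have e1 : Filter.Tendsto (fun y => min 1 (y / x) * g x) (nhds x) (nhds (g x)) := by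
        have : Continuous (fun y => min 1 (y / x) * g x) := by fun_prop
        simpa [div_self hx0.ne'] using this.tendsto x
      have e2 : Filter.Tendsto (fun y => max 1 (y / x) * g x) (nhds x) (nhds (g x)) := by
        have : Continuous (fun y => max 1 (y / x) * g x) := by fun_prop
        simpa [div_self hx0.ne'] using this.tendsto x
      refine tendsto_of_tendsto_of_tendsto_of_le_of_le' e1 e2 ?_ ?_
      · filter_upwards [lt_mem_nhds hx0] with y hy
        rcases le_total x y with h | h
        · rw [min_eq_left ((one_le_div hx0).2 h), one_mul]
          exact hgmono h
        · rw [min_eq_right ((div_le_one hx0).2 h)]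
          have h1 := mul_le_mul_of_nonneg_left (hscale y x hy h) (div_pos hy hx0).le
          have h2 : y / x * (x / y * g y) = g y := by field_simp
          linarith
      · filter_upwards [lt_mem_nhds hx0] with y hy
        rcases le_total x y with h | h
        · rw [max_eq_right ((one_le_div hx0).2 h)]
          exact hscale x y hx0 h
        · rw [max_eq_left ((div_le_one hx0).2 h), one_mul]
          exact hgmono h
  refine ⟨fun r => g r + r, ⟨hcont.add continuousOn_id, ?_, by simp [hg0]⟩, ?_⟩
  · intro a _ b _ hab
    exact add_lt_add_of_le_of_lt (hgmono hab.le) hab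
  · intro r hr'
    have h := hle r r hr'
    rw [div_self hr'.1.ne', min_self, mul_one] at h
    have := hr'.1
    show q r ≤ g r + r
    linarith
end

section
/- Let S, D ⊆ ℝⁿ be compact, non-empty sets with S ⊆ D and D \ S non-empty, let U ⊆ ℝᵐ be compact and non-empty, let f : ℝⁿ × ℝᵐ → ℝⁿ be continuous, and let h : ℝⁿ → ℝ be continuous with S = { x ∈ ℝⁿ : h(x) ≤ 0 }. Assume there exists a continuous function Δh : ℝⁿ → ℝ with Δh(x) > 0 for all x ∈ D \ S such that: (a) for every x ∈ D \ S there exists u ∈ U with f(x, u) ∈ D and h(f(x, u)) − h(x) ≤ −Δh(x); and (b) for every x ∈ S there exists u ∈ U with h(f(x, u)) ≤ 0. Define h̃(x) := max{0, h(x)} and r̄ := max_{x ∈ D} ‖x‖_S. Then there exist class K functions α₁, α₂, α₃ : [0, r̄] → ℝ such that for every x ∈ D: (i) α₁(‖x‖_S) ≤ h̃(x) ≤ α₂(‖x‖_S), and (ii) there exists u ∈ U with f(x, u) ∈ D and h̃(f(x, u)) − h̃(x) ≤ −α₃(‖x‖_S). -/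
/-- `rbar = max_{x ∈ D} ‖x‖_S`. -/
noncomputable def rbarOf {n : ℕ} (S D : Set (EuclideanSpace ℝ (Fin n))) : ℝ :=
  sSup ((fun x => Metric.infDist x S) '' D)

lemma auxA {X : Type*} [TopologicalSpace X] (D : Set X) (hD : IsCompact D) (hne : D.Nonempty)
    (p q : X → ℝ) (hp : Continuous p) (hq : Continuous q) (hp0 : ∀ x ∈ D, 0 ≤ p x)
    (hq0 : ∀ x ∈ D, 0 ≤ q x) (hpq : ∀ x ∈ D, 0 < p x → 0 < q x) :
    ∃ φ : ℝ → ℝ, Continuous φ ∧ Monotone φ ∧ (∀ s, 0 ≤ φ s) ∧ (∀ s, 0 < s → 0 < φ s) ∧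
      (∀ x ∈ D, φ (p x) ≤ q x) ∧ ∃ P, (∀ x ∈ D, p x ≤ P) ∧ ∀ s, s - P ≤ φ s := by
  have key : ∀ s : ℝ, ∃ x ∈ D, ∀ y ∈ D, q x + max 0 (s - p x) ≤ q y + max 0 (s - p y) := by
    intro s
    have hc : ContinuousOn (fun x => q x + max 0 (s - p x)) D := by fun_prop
    obtain ⟨x, hx, hm⟩ := hD.exists_isMinOn hne hc
    exact ⟨x, hx, fun y hy => hm hy⟩
  choose m hmD hm using key
  obtain ⟨z, hz, hP⟩ := hD.exists_isMaxOn hne hp.continuousOn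
  refine ⟨fun s => q (m s) + max 0 (s - p (m s)), ?_, ?_, ?_, ?_, ?_, p z, fun x hx => hP hx, ?_⟩
  · apply LipschitzWith.continuous (K := 1)
    apply LipschitzWith.of_le_add
    intro s t
    have h1 := hm s (m t) (hmD t)
    have h2 : max 0 (s - p (m t)) ≤ max 0 (t - p (m t)) + dist s t := by
      rw [Real.dist_eq]
      have := le_abs_self (s - t)
      have := abs_nonneg (s - t)
      have := le_max_left 0 (t - p (m t))
      have := le_max_right 0 (t - p (m t))
      apply max_le <;> linarith
    linarith
  · intro s t hst
    have h1 := hm s (m t) (hmD t)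
    have h2 : max 0 (s - p (m t)) ≤ max 0 (t - p (m t)) := max_le_max le_rfl (by linarith)
    dsimp only
    linarith
  · intro s
    have := hq0 _ (hmD s)
    positivity
  · intro s hs
    have h0 := hq0 _ (hmD s)
    have h1 := le_max_left 0 (s - p (m s))
    have h2 := le_max_right 0 (s - p (m s))
    dsimp only
    rcases (hp0 _ (hmD s)).lt_or_eq with h | h
    · have := hpq _ (hmD s) h
      linarith
    · linarith
  · intro x hx
    have := hm (p x) x hx
    simpa using this
  · intro s
    have h0 := hq0 _ (hmD s)
    have h2 := le_max_right 0 (s - p (m s))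
    have h3 : p (m s) ≤ p z := hP (hmD s)
    dsimp only
    linarith

lemma auxB {X : Type*} [TopologicalSpace X] (D : Set X) (hD : IsCompact D) (hne : D.Nonempty)
    (p q : X → ℝ) (hp : Continuous p) (hq : Continuous q) (hp0 : ∀ x ∈ D, 0 ≤ p x)
    (hq0 : ∀ x ∈ D, 0 ≤ q x) (hpq : ∀ x ∈ D, 0 < p x → 0 < q x) :
    ∃ β : ℝ → ℝ, Continuous β ∧ StrictMono β ∧ Function.Surjective β ∧ β 0 = 0 ∧
      (∀ x ∈ D, β (p x) ≤ q x) := by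
  obtain ⟨φ, hc, hmono, h0, hpos, hle, P, hP, hlow⟩ := auxA D hD hne p q hp hq hp0 hq0 hpq
  have hP0 : 0 ≤ P := by
    obtain ⟨x, hx⟩ := hne
    exact (hp0 x hx).trans (hP x hx)
  have hcont : Continuous (fun s => s / (1 + P) * φ |s|) := by fun_prop
  have hodd : ∀ s, (fun s => s / (1 + P) * φ |s|) (-s) = -(fun s => s / (1 + P) * φ |s|) s := by
    intro s
    simp only [abs_neg]
    ring
  have htop : Filter.Tendsto (fun s => s / (1 + P) * φ |s|) Filter.atTop Filter.atTop := by
    apply Filter.Tendsto.atTop_mul_atTop₀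
    · exact Filter.tendsto_id.atTop_div_const (by positivity)
    · apply Filter.tendsto_atTop_mono (f := fun s => s - P)
      · intro s
        have := hlow |s|
        have := le_abs_self s
        linarith
      · exact Filter.tendsto_atTop_add_const_right _ _ Filter.tendsto_id
  refine ⟨fun s => s / (1 + P) * φ |s|, hcont, ?_, ?_, by simp, ?_⟩
  · apply strictMono_of_odd_strictMonoOn_nonneg hodd
    intro s hs t ht hst
    simp only [Set.mem_Ici] at hs ht
    dsimp only
    rw [abs_of_nonneg hs, abs_of_nonneg ht]
    have h1 : φ s ≤ φ t := hmono hst.le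
    have h2 : 0 < φ t := hpos t (by linarith)
    calc s / (1 + P) * φ s ≤ s / (1 + P) * φ t := by gcongr
      _ < t / (1 + P) * φ t := by gcongr
  · apply hcont.surjective htop
    have := Filter.tendsto_neg_atTop_atBot.comp (htop.comp Filter.tendsto_neg_atBot_atTop)
    refine this.congr ?_
    intro s
    simp only [Function.comp, abs_neg]
    ring
  · intro x hx
    dsimp only
    rw [abs_of_nonneg (hp0 x hx)]
    refine le_trans ?_ (hle x hx)
    apply mul_le_of_le_one_left (h0 _)
    rw [div_le_one (by positivity)]
    linarith [hP x hx]

/-- Theorem (relation of CBF definitions): if `h` is a continuity-based discrete-time CBF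
with safe set `S = {x : h x ≤ 0}`, domain `D` and decrease `Δh`, then
`h̃ x = max 0 (h x)` is a class-`𝒦` based CBF: it admits class-`𝒦` bounds
`α₁(‖x‖_S) ≤ h̃ x ≤ α₂(‖x‖_S)` on `D` and a class-`𝒦` decrease `α₃`. -/
theorem stmt5 {n m : ℕ}
    (S D : Set (EuclideanSpace ℝ (Fin n)))
    (hScomp : IsCompact S) (hSne : S.Nonempty)
    (hDcomp : IsCompact D) (hDne : D.Nonempty)
    (hSD : S ⊆ D) (hDSne : (D \ S).Nonempty)
    (U : Set (EuclideanSpace ℝ (Fin m))) (hUcomp : IsCompact U) (hUne : U.Nonempty)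
    (f : EuclideanSpace ℝ (Fin n) × EuclideanSpace ℝ (Fin m) → EuclideanSpace ℝ (Fin n))
    (hfc : Continuous f)
    (h : EuclideanSpace ℝ (Fin n) → ℝ) (hhc : Continuous h)
    (hSdef : S = {x | h x ≤ 0})
    (Δh : EuclideanSpace ℝ (Fin n) → ℝ) (hΔc : Continuous Δh)
    (hΔpos : ∀ x ∈ D \ S, 0 < Δh x)
    (ha : ∀ x ∈ D \ S, ∃ u ∈ U, f (x, u) ∈ D ∧ h (f (x, u)) - h x ≤ -Δh x)
    (hb : ∀ x ∈ S, ∃ u ∈ U, h (f (x, u)) ≤ 0) :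
    ∃ α₁ α₂ α₃ : ℝ → ℝ,
      IsClassKOn α₁ (rbarOf S D) ∧ IsClassKOn α₂ (rbarOf S D) ∧ IsClassKOn α₃ (rbarOf S D) ∧
      ∀ x ∈ D,
        (α₁ (Metric.infDist x S) ≤ max 0 (h x) ∧ max 0 (h x) ≤ α₂ (Metric.infDist x S)) ∧
        ∃ u ∈ U, f (x, u) ∈ D ∧
          max 0 (h (f (x, u))) - max 0 (h x) ≤ -α₃ (Metric.infDist x S) := by
  have hmem : ∀ x, x ∈ S ↔ h x ≤ 0 := fun x => by rw [hSdef]; rfl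
  have hd0 : ∀ x, 0 < Metric.infDist x S ↔ 0 < h x := by
    intro x
    rw [← hScomp.isClosed.notMem_iff_infDist_pos hSne, hmem, not_le]
  have hdc : Continuous (fun x => Metric.infDist x S) := Metric.continuous_infDist_pt S
  obtain ⟨a, ac, am, -, a0, ale⟩ := auxB D hDcomp hDne (fun x => Metric.infDist x S)
    (fun x => max 0 (h x)) hdc (by fun_prop) (fun x _ => Metric.infDist_nonneg)
    (fun x _ => le_max_left _ _)
    (fun x _ hx => lt_max_of_lt_right ((hd0 x).1 hx))
  obtain ⟨b, bc, bm, bs, b0, ble⟩ := auxB D hDcomp hDne (fun x => max 0 (h x))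
    (fun x => Metric.infDist x S) (by fun_prop) hdc
    (fun x _ => le_max_left _ _) (fun x _ => Metric.infDist_nonneg)
    (fun x _ hx => (hd0 x).2 (by simpa using hx))
  obtain ⟨c, cc, cm, -, c0, cle⟩ := auxB D hDcomp hDne (fun x => Metric.infDist x S)
    (fun x => max 0 (min (h x) (Δh x))) hdc (by fun_prop) (fun x _ => Metric.infDist_nonneg)
    (fun x _ => le_max_left _ _)
    (fun x hx hx0 => by
      have h1 := (hd0 x).1 hx0
      exact lt_max_of_lt_right (lt_min h1 (hΔpos x ⟨hx, by rw [hmem]; linarith⟩)))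
  let e := bm.orderIsoOfSurjective b bs
  have he : ∀ s, e s = b s := fun s => rfl
  refine ⟨a, e.symm, c, ⟨ac.continuousOn, am.strictMonoOn _, a0⟩,
    ⟨e.symm.continuous.continuousOn, e.symm.strictMono.strictMonoOn _, ?_⟩,
    ⟨cc.continuousOn, cm.strictMonoOn _, c0⟩, ?_⟩
  · rw [OrderIso.symm_apply_eq, he, b0]
  intro x hx
  refine ⟨⟨ale x hx, ?_⟩, ?_⟩
  · rw [OrderIso.le_symm_apply, he]
    exact ble x hx
  by_cases hxS : x ∈ S
  · obtain ⟨u, hu, hfu⟩ := hb x hxS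
    refine ⟨u, hu, hSD ((hmem _).2 hfu), ?_⟩
    rw [Metric.infDist_zero_of_mem hxS, c0, max_eq_left hfu, max_eq_left ((hmem x).1 hxS)]
    simp
  · obtain ⟨u, hu, hfD, hfu⟩ := ha x ⟨hx, hxS⟩
    refine ⟨u, hu, hfD, ?_⟩
    have h1 : 0 < h x := by rw [hmem] at hxS; linarith
    have h2 := hΔpos x ⟨hx, hxS⟩
    have h3 := cle x hx
    rw [max_eq_right (lt_min h1 h2).le] at h3
    have h4 := h3.trans (min_le_left _ _)
    have h5 := h3.trans (min_le_right _ _)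
    rw [max_eq_right h1.le]
    have : max 0 (h (f (x, u))) ≤ h x - c (Metric.infDist x S) := max_le (by linarith) (by linarith)
    linarith
end

section
/- Let S, D ⊆ ℝⁿ be compact, non-empty sets with S ⊆ D, and let h : ℝⁿ → ℝ be continuous with S = { x ∈ ℝⁿ : h(x) ≤ 0 }. Define h̃(x) := max{0, h(x)} and r̄ := max_{x ∈ D} ‖x‖_S, and assume r̄ > 0. Then there exist class K functions α₁, α₂ : [0, r̄] → ℝ such that α₁(‖x‖_S) ≤ h̃(x) ≤ α₂(‖x‖_S) for all x ∈ D. -/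
theorem stmt6 {n : ℕ}
    (S D : Set (EuclideanSpace ℝ (Fin n)))
    (hScomp : IsCompact S) (hSne : S.Nonempty)
    (hDcomp : IsCompact D) (hDne : D.Nonempty)
    (hSD : S ⊆ D)
    (h : EuclideanSpace ℝ (Fin n) → ℝ) (hhc : Continuous h)
    (hSdef : S = {x | h x ≤ 0})
    (hrpos : 0 < rbarOf S D) :
    ∃ α₁ α₂ : ℝ → ℝ,
      IsClassKOn α₁ (rbarOf S D) ∧ IsClassKOn α₂ (rbarOf S D) ∧
      ∀ x ∈ D,
        α₁ (Metric.infDist x S) ≤ max 0 (h x) ∧ max 0 (h x) ≤ α₂ (Metric.infDist x S) := by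
  have hdc : Continuous (fun x => Metric.infDist x S) := Metric.continuous_infDist_pt S
  have hle : ∀ x ∈ D, Metric.infDist x S ≤ rbarOf S D := fun x hx =>
    le_csSup (hDcomp.image hdc).bddAbove (Set.mem_image_of_mem _ hx)
  set R := rbarOf S D with hR
  have hS0 : ∀ x ∈ S, max 0 (h x) = 0 := by
    intro x hx
    rw [hSdef] at hx
    exact max_eq_left hx
  -- lower bound
  let f : ℝ → EuclideanSpace ℝ (Fin n) → ℝ :=
    fun r x => max 0 (h x) + max 0 (r - Metric.infDist x S)
  have hf : Continuous (fun p : ℝ × EuclideanSpace ℝ (Fin n) => f p.1 p.2) := by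
    have := hdc.comp (continuous_snd (X := ℝ))
    have h2 := hhc.comp (continuous_snd (X := ℝ))
    exact (continuous_const.max h2).add (continuous_const.max (continuous_fst.sub this))
  let φ : ℝ → ℝ := fun r => sInf (f r '' D)
  have hφc : Continuous φ := hDcomp.continuous_sInf (f := f) hf
  have hfr : ∀ r, Continuous (f r) := fun r => hf.comp (Continuous.prodMk_right r)
  have hφle : ∀ r, ∀ x ∈ D, φ r ≤ f r x := fun r x hx =>
    csInf_le (hDcomp.image (hfr r)).bddBelow (Set.mem_image_of_mem _ hx)
  have hφat : ∀ r, ∃ x ∈ D, φ r = f r x := fun r =>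
    hDcomp.exists_sInf_image_eq hDne (hfr r).continuousOn
  have hφpos : ∀ r, 0 < r → 0 < φ r := by
    intro r hr
    obtain ⟨x, hx, he⟩ := hφat r
    rw [he]
    by_cases hxS : x ∈ S
    · have : Metric.infDist x S = 0 := Metric.infDist_zero_of_mem hxS
      simp only [f, this, sub_zero]
      have := le_max_left 0 (h x)
      have := le_max_right 0 r
      linarith
    · have hx' : 0 < h x := by
        rw [hSdef] at hxS
        simpa using hxS
      have := le_max_right 0 (h x)
      have := le_max_left 0 (r - Metric.infDist x S)
      simp only [f]
      linarith
  have hφmono : Monotone φ := by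
    intro a b hab
    obtain ⟨x, hx, he⟩ := hφat b
    rw [he]
    refine (hφle a x hx).trans ?_
    simp only [f]
    gcongr
  -- upper bound
  let K : Set (EuclideanSpace ℝ (Fin n) × EuclideanSpace ℝ (Fin n)) :=
    S ×ˢ Metric.closedBall 0 1
  have hK : IsCompact K := hScomp.prod (isCompact_closedBall 0 1)
  have hKne : K.Nonempty := hSne.prod ⟨0, by simp⟩
  let g : ℝ → EuclideanSpace ℝ (Fin n) × EuclideanSpace ℝ (Fin n) → ℝ :=
    fun r p => max 0 (h (p.1 + r • p.2))
  have hg : Continuous (fun p : ℝ × (EuclideanSpace ℝ (Fin n) × EuclideanSpace ℝ (Fin n)) =>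
      g p.1 p.2) := by
    refine continuous_const.max (hhc.comp ?_)
    fun_prop
  let ψ : ℝ → ℝ := fun r => sSup (g r '' K)
  have hψc : Continuous ψ := hK.continuous_sSup (f := g) hg
  have hgr : ∀ r, Continuous (g r) := fun r => hg.comp (Continuous.prodMk_right r)
  have hψge : ∀ r, ∀ p ∈ K, g r p ≤ ψ r := fun r p hp =>
    le_csSup (hK.image (hgr r)).bddAbove (Set.mem_image_of_mem _ hp)
  have hψat : ∀ r, ∃ p ∈ K, ψ r = g r p := fun r =>
    hK.exists_sSup_image_eq hKne (hgr r).continuousOn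
  have hψ0 : ψ 0 = 0 := by
    obtain ⟨p, hp, he⟩ := hψat 0
    rw [he]
    simp only [g, zero_smul, add_zero]
    exact hS0 _ hp.1
  have hψmono : ∀ a b, 0 ≤ a → a < b → ψ a ≤ ψ b := by
    intro a b ha hab
    obtain ⟨⟨s, u⟩, hp, he⟩ := hψat a
    have hb : 0 < b := ha.trans_lt hab
    have hu : ‖u‖ ≤ 1 := by simpa using hp.2
    have := hψge b (s, (a / b) • u) ⟨hp.1, by
      have h1 : a / b ≤ 1 := (div_le_one hb).2 hab.le
      have h0 : 0 ≤ a / b := by positivity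
      simp only [Metric.mem_closedBall, dist_zero_right, norm_smul, Real.norm_eq_abs,
        abs_of_nonneg h0]
      exact mul_le_one₀ h1 (norm_nonneg _) hu⟩
    rw [he]
    refine le_trans (le_of_eq ?_) this
    simp only [g, smul_smul, mul_div_cancel₀ a hb.ne']
  refine ⟨fun r => φ r * (r / R), fun r => ψ r + r, ⟨?_, ?_, by simp⟩, ⟨?_, ?_, by simp [hψ0]⟩, ?_⟩
  · exact (hφc.mul (continuous_id.div_const R)).continuousOn
  · intro a ha b hb hab
    have hb0 : 0 < b := ha.1.trans_lt hab
    have h1 : φ a * (a / R) ≤ φ b * (a / R) :=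
      mul_le_mul_of_nonneg_right (hφmono hab.le) (div_nonneg ha.1 hrpos.le)
    have h2 : φ b * (a / R) < φ b * (b / R) :=
      mul_lt_mul_of_pos_left (div_lt_div_of_pos_right hab hrpos) (hφpos b hb0)
    exact h1.trans_lt h2
  · exact (hψc.add continuous_id).continuousOn
  · intro a ha b hb hab
    exact add_lt_add_of_le_of_lt (hψmono a b ha.1 hab) hab
  · intro x hx
    have hd0 : 0 ≤ Metric.infDist x S := Metric.infDist_nonneg
    constructor
    · have h1 := hφle (Metric.infDist x S) x hx
      simp only [f, sub_self, max_self, add_zero] at h1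
      have h2 : Metric.infDist x S / R ≤ 1 := (div_le_one hrpos).2 (hle x hx)
      have h3 : 0 ≤ Metric.infDist x S / R := by positivity
      calc φ (Metric.infDist x S) * (Metric.infDist x S / R)
          ≤ max 0 (h x) * (Metric.infDist x S / R) := mul_le_mul_of_nonneg_right h1 h3
        _ ≤ max 0 (h x) := mul_le_of_le_one_right (le_max_left _ _) h2
    · obtain ⟨s, hs, he⟩ := hScomp.exists_infDist_eq_dist hSne x
      set r := Metric.infDist x S with hr
      have hn : ‖x - s‖ = r := by rw [he, dist_eq_norm]
      have h1 := hψge r (s, r⁻¹ • (x - s)) ⟨hs, by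
        simp only [Metric.mem_closedBall, dist_zero_right, norm_smul, Real.norm_eq_abs, hn,
          abs_inv, abs_of_nonneg hd0]
        exact inv_mul_le_one⟩
      have h2 : s + r • r⁻¹ • (x - s) = x := by
        by_cases h0 : r = 0
        · rw [h0, norm_eq_zero, sub_eq_zero] at hn
          simp [h0, hn]
        · rw [smul_inv_smul₀ h0]; abel
      simp only [g, h2] at h1
      linarith
end

section
/- Let U ⊆ ℝᵐ be compact and non-empty, let f : ℝⁿ × ℝᵐ → ℝⁿ be continuous, let ĥ : ℝⁿ → ℝ be continuous, and let γ̂ > 0. Define Ŝ := { x ∈ ℝⁿ : ĥ(x) ≤ 0 } and D̂ := { x ∈ ℝⁿ : ĥ(x) ≤ γ̂ }, and assume Ŝ is non-empty and D̂ is compact with D̂ \ Ŝ non-empty. Define Δĥ(x) := max_{u ∈ U} ( ĥ(x) − ĥ(f(x, u)) ). Assume Δĥ(x) > 0 for all x ∈ D̂ \ Ŝ, and that for every x ∈ Ŝ there exists u ∈ U with ĥ(f(x, u)) ≤ 0. Then, with h̃(x) := max{0, ĥ(x)} and r̄ := max_{x ∈ D̂} ‖x‖_{Ŝ}, there exist class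 K functions α₁, α₂, α₃ : [0, r̄] → ℝ such that for every x ∈ D̂: (i) α₁(‖x‖_{Ŝ}) ≤ h̃(x) ≤ α₂(‖x‖_{Ŝ}), and (ii) there exists u ∈ U with f(x, u) ∈ D̂ and h̃(f(x, u)) − h̃(x) ≤ −α₃(‖x‖_{Ŝ}). -/
lemma exists_lower_K {X : Type*} [TopologicalSpace X] (K : Set X) (hK : IsCompact K)
    (hne : K.Nonempty) (d g : X → ℝ) (hd : Continuous d) (hg : Continuous g)
    (hd0 : ∀ x ∈ K, 0 ≤ d x) (hg0 : ∀ x ∈ K, 0 ≤ g x) (hpos : ∀ x ∈ K, 0 < d x → 0 < g x) :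
    ∃ α : ℝ → ℝ, Continuous α ∧ StrictMono α ∧ Function.Surjective α ∧ α 0 = 0 ∧
      ∀ x ∈ K, α (d x) ≤ g x := by
  obtain ⟨M, hM⟩ := hK.bddAbove_image hd.continuousOn
  have hM' : ∀ x ∈ K, d x ≤ M := fun x hx => hM ⟨x, hx, rfl⟩
  have hM0 : 0 ≤ M := by
    obtain ⟨x, hx⟩ := hne
    exact (hd0 x hx).trans (hM' x hx)
  have : Nonempty K := hne.to_subtype
  let φ : ℝ → ℝ := fun r => ⨅ x : K, (g x + max 0 (r - d x))
  have hnn : ∀ r, ∀ x : K, 0 ≤ g x + max 0 (r - d x) := fun r x =>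
    add_nonneg (hg0 x x.2) (le_max_left _ _)
  have hbdd : ∀ r, BddBelow (Set.range fun x : K => g x + max 0 (r - d x)) := by
    intro r
    refine ⟨0, ?_⟩
    rintro _ ⟨x, rfl⟩
    exact hnn r x
  have hφle : ∀ r, ∀ x : K, φ r ≤ g x + max 0 (r - d x) := fun r x => ciInf_le (hbdd r) x
  have hφ0 : ∀ r, 0 ≤ φ r := fun r => le_ciInf (hnn r)
  have hφmono : Monotone φ := by
    intro a b hab
    refine le_ciInf fun x => (hφle a x).trans ?_
    gcongr
  have hφc : Continuous φ := by
    have : LipschitzWith 1 φ := by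
      refine LipschitzWith.of_le_add fun a b => ?_
      rw [← sub_le_iff_le_add]
      refine le_ciInf fun x => ?_
      have h1 := hφle a x
      have h2 : max 0 (a - d x) ≤ max 0 (b - d x) + dist a b := by
        rw [Real.dist_eq]
        have := le_abs_self (a - b)
        have := abs_nonneg (a - b)
        have := le_max_left 0 (b - d x)
        have := le_max_right 0 (b - d x)
        apply max_le <;> linarith
      linarith
    exact this.continuous
  have hφpos : ∀ r, 0 < r → 0 < φ r := by
    intro r hr
    obtain ⟨x, hx, hmin⟩ := hK.exists_isMinOn hne
      (f := fun x => g x + max 0 (r - d x)) (by fun_prop)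
    have h1 : g x + max 0 (r - d x) ≤ φ r := le_ciInf fun y => hmin y.2
    refine lt_of_lt_of_le ?_ h1
    rcases lt_or_ge 0 (d x) with h | h
    · exact add_pos_of_pos_of_nonneg (hpos x hx h) (le_max_left _ _)
    · exact add_pos_of_nonneg_of_pos (hg0 x hx) (lt_max_of_lt_right (by linarith))
  let q : ℝ → ℝ := fun r => max r 0 / (1 + max r 0)
  have hq : ∀ r, q r = 1 - 1 / (1 + max r 0) := by
    intro r
    have : 0 < 1 + max r 0 := by positivity
    simp only [q]
    field_simp
    ring
  have hq0 : ∀ r, 0 ≤ q r := fun r => by simp only [q]; positivity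
  have hq1 : ∀ r, q r ≤ 1 := fun r => by
    rw [hq]
    have : 0 ≤ 1 / (1 + max r 0) := by positivity
    linarith
  have hqm : Monotone q := by
    intro a b hab
    rw [hq, hq]
    gcongr
  have hqs : ∀ a b, 0 ≤ a → a < b → q a < q b := by
    intro a b ha hab
    rw [hq, hq, max_eq_left ha, max_eq_left (ha.trans hab.le)]
    have := one_div_lt_one_div_of_lt (by linarith : 0 < 1 + a) (by linarith : 1 + a < 1 + b)
    linarith
  have hqc : Continuous q := by
    refine Continuous.div (by fun_prop) (by fun_prop) fun r => ?_
    have : 0 < 1 + max r 0 := by positivity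
    exact this.ne'
  let α : ℝ → ℝ := fun r => φ r * q r + min r 0 + max 0 (r - M)
  have hαc : Continuous α := by
    simp only [α]
    fun_prop
  have hm2 : ∀ a b : ℝ, a ≤ b → max 0 (a - M) ≤ max 0 (b - M) := fun a b h => by gcongr
  refine ⟨α, hαc, ?_, ?_, ?_, ?_⟩
  · intro a b hab
    have h3 := hm2 a b hab.le
    have h2 : min a 0 ≤ min b 0 := by gcongr
    have h1 : φ a * q a ≤ φ b * q b :=
      mul_le_mul (hφmono hab.le) (hqm hab.le) (hq0 _) (hφ0 _)
    simp only [α]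
    rcases lt_or_ge a 0 with ha | ha
    · have : min a 0 < min b 0 := by
        rw [min_eq_left ha.le]
        exact lt_min hab ha
      linarith
    · have : φ a * q a < φ b * q b :=
        mul_lt_mul' (hφmono hab.le) (hqs a b ha hab) (hq0 _) (hφpos b (by linarith))
      linarith
  · refine hαc.surjective ?_ ?_
    · refine Filter.tendsto_atTop_mono' _ (f₁ := fun r => r - M) ?_
        (Filter.tendsto_atTop_add_const_right _ _ Filter.tendsto_id)
      filter_upwards [Filter.eventually_ge_atTop 0] with r hr
      simp only [α]
      have := mul_nonneg (hφ0 r) (hq0 r)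
      have := le_max_right 0 (r - M)
      rw [min_eq_right hr]
      linarith
    · refine Filter.tendsto_atBot_mono' (Filter.atBot : Filter ℝ) (f₁ := fun r : ℝ => r) ?_ Filter.tendsto_id
      filter_upwards [Filter.eventually_le_atBot 0] with r hr
      simp only [α, q]
      rw [max_eq_right hr, min_eq_left hr, max_eq_left (by linarith)]
      simp
  · simp [α, q, hM0]
  · intro x hx
    simp only [α]
    have h1 := hφle (d x) ⟨x, hx⟩
    simp only [sub_self, max_self, add_zero] at h1
    rw [min_eq_right (hd0 x hx), max_eq_left (by linarith [hM' x hx])]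
    have := mul_le_of_le_one_right (hφ0 (d x)) (hq1 (d x))
    linarith

/-- If `hhat` is continuous with `Ŝ = {x : hhat x ≤ 0}` nonempty, `D̂ = {x : hhat x ≤ ghat}` compact,
`D̂ \ Ŝ` nonempty, the maximal decrease `Δhhat x = max_{u ∈ U} (hhat x - hhat (f (x, u)))` is
positive on `D̂ \ Ŝ`, and `Ŝ` is control invariant, then `h̃ x = max 0 (hhat x)` is a
class-`𝒦` based CBF with safe set `Ŝ` and domain `D̂`. -/
theorem stmt7 {n m : ℕ}
    (U : Set (EuclideanSpace ℝ (Fin m))) (hUcomp : IsCompact U) (hUne : U.Nonempty)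
    (f : EuclideanSpace ℝ (Fin n) × EuclideanSpace ℝ (Fin m) → EuclideanSpace ℝ (Fin n))
    (hfc : Continuous f)
    (hhat : EuclideanSpace ℝ (Fin n) → ℝ) (hhhatc : Continuous hhat)
    (ghat : ℝ) (hghat : 0 < ghat)
    (hSne : {x : EuclideanSpace ℝ (Fin n) | hhat x ≤ 0}.Nonempty)
    (hDcomp : IsCompact {x : EuclideanSpace ℝ (Fin n) | hhat x ≤ ghat})
    (hDSne : ({x : EuclideanSpace ℝ (Fin n) | hhat x ≤ ghat} \ {x | hhat x ≤ 0}).Nonempty)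
    (hΔpos : ∀ x ∈ {x : EuclideanSpace ℝ (Fin n) | hhat x ≤ ghat} \ {x | hhat x ≤ 0},
      0 < sSup ((fun u => hhat x - hhat (f (x, u))) '' U))
    (hinv : ∀ x ∈ {x : EuclideanSpace ℝ (Fin n) | hhat x ≤ 0}, ∃ u ∈ U, hhat (f (x, u)) ≤ 0) :
    ∃ α₁ α₂ α₃ : ℝ → ℝ,
      IsClassKOn α₁ (rbarOf {x | hhat x ≤ 0} {x | hhat x ≤ ghat}) ∧
      IsClassKOn α₂ (rbarOf {x | hhat x ≤ 0} {x | hhat x ≤ ghat}) ∧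
      IsClassKOn α₃ (rbarOf {x | hhat x ≤ 0} {x | hhat x ≤ ghat}) ∧
      ∀ x ∈ {x : EuclideanSpace ℝ (Fin n) | hhat x ≤ ghat},
        (α₁ (Metric.infDist x {x | hhat x ≤ 0}) ≤ max 0 (hhat x) ∧
          max 0 (hhat x) ≤ α₂ (Metric.infDist x {x | hhat x ≤ 0})) ∧
        ∃ u ∈ U, f (x, u) ∈ {x : EuclideanSpace ℝ (Fin n) | hhat x ≤ ghat} ∧
          max 0 (hhat (f (x, u))) - max 0 (hhat x) ≤
            -α₃ (Metric.infDist x {x | hhat x ≤ 0}) := by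
  set S : Set (EuclideanSpace ℝ (Fin n)) := {x | hhat x ≤ 0} with hS
  set D : Set (EuclideanSpace ℝ (Fin n)) := {x | hhat x ≤ ghat} with hD
  have hSclosed : IsClosed S := isClosed_le hhhatc continuous_const
  have hDne : D.Nonempty := hDSne.mono Set.sdiff_subset
  let d : EuclideanSpace ℝ (Fin n) → ℝ := fun x => Metric.infDist x S
  let t : EuclideanSpace ℝ (Fin n) → ℝ := fun x => max 0 (hhat x)
  have hdc : Continuous d := Metric.continuous_infDist_pt S
  have htc : Continuous t := continuous_const.max hhhatc
  have hd0 : ∀ x, 0 ≤ d x := fun x => Metric.infDist_nonneg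
  have ht0 : ∀ x, 0 ≤ t x := fun x => le_max_left _ _
  have hdpos : ∀ x, 0 < d x → 0 < hhat x := by
    intro x hx
    by_contra h
    have hxS : x ∈ S := not_lt.mp h
    have : d x = 0 := Metric.infDist_zero_of_mem hxS
    linarith
  have hposd : ∀ x, 0 < t x → 0 < d x := by
    intro x hx
    refine (hSclosed.notMem_iff_infDist_pos hSne).mp ?_
    intro hxS
    have : t x = 0 := max_eq_left hxS
    linarith
  let F : EuclideanSpace ℝ (Fin n) → EuclideanSpace ℝ (Fin m) → ℝ :=
    fun x u => t x - t (f (x, u))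
  have hFc : Continuous (Function.uncurry F) := by
    simp only [F, Function.uncurry_def]
    fun_prop
  let G : EuclideanSpace ℝ (Fin n) → ℝ := fun x => sSup (F x '' U)
  have hGc : Continuous G := hUcomp.continuous_sSup hFc
  have hFx : ∀ x, Continuous (F x) := fun x => by
    simp only [F]
    fun_prop
  have hGle : ∀ x, ∀ u ∈ U, F x u ≤ G x := fun x u hu =>
    le_csSup (hUcomp.bddAbove_image (hFx x).continuousOn) ⟨u, hu, rfl⟩
  have hGpos : ∀ x ∈ D, 0 < hhat x → 0 < G x := by
    intro x hx hpx
    have h := hΔpos x ⟨hx, not_le.mpr hpx⟩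
    obtain ⟨_, ⟨u, hu, rfl⟩, h2⟩ := exists_lt_of_lt_csSup (hUne.image _) h
    refine lt_of_lt_of_le ?_ (hGle x u hu)
    simp only [F, t]
    rw [max_eq_right hpx.le, sub_pos]
    exact max_lt hpx (by simpa using h2)
  have hG0 : ∀ x ∈ D, 0 ≤ G x := by
    intro x hx
    rcases lt_or_ge 0 (hhat x) with h | h
    · exact (hGpos x hx h).le
    · obtain ⟨u, hu, h2⟩ := hinv x h
      refine le_trans ?_ (hGle x u hu)
      simp only [F, t]
      rw [max_eq_left h, max_eq_left h2, sub_self]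
  obtain ⟨α₁, c1, m1, -, z1, l1⟩ := exists_lower_K D hDcomp hDne d t hdc htc
    (fun x _ => hd0 x) (fun x _ => ht0 x) (fun x _ h => lt_max_of_lt_right (hdpos x h))
  obtain ⟨β, c2, m2, s2, z2, l2⟩ := exists_lower_K D hDcomp hDne t d htc hdc
    (fun x _ => ht0 x) (fun x _ => hd0 x) (fun x _ h => hposd x h)
  obtain ⟨α₃, c3, m3, -, z3, l3⟩ := exists_lower_K D hDcomp hDne d G hdc hGc
    (fun x _ => hd0 x) hG0 (fun x hx h => hGpos x hx (hdpos x h))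
  let e : ℝ ≃o ℝ := m2.orderIsoOfSurjective β s2
  have he : ∀ x, e x = β x := fun x => rfl
  refine ⟨α₁, e.symm, α₃, ⟨c1.continuousOn, m1.strictMonoOn _, z1⟩,
    ⟨e.symm.continuous.continuousOn, e.symm.strictMono.strictMonoOn _, ?_⟩,
    ⟨c3.continuousOn, m3.strictMonoOn _, z3⟩, ?_⟩
  · rw [e.symm_apply_eq, he, z2]
  · intro x hx
    refine ⟨⟨l1 x hx, ?_⟩, ?_⟩
    · rw [e.le_symm_apply, he]
      exact l2 x hx
    · obtain ⟨u, hu, hmax⟩ := hUcomp.exists_sSup_image_eq hUne (hFx x).continuousOn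
      have h3 : α₃ (d x) ≤ F x u := (l3 x hx).trans_eq hmax
      have h0 : 0 ≤ F x u := (hG0 x hx).trans_eq hmax
      refine ⟨u, hu, ?_, ?_⟩
      · have h4 : hhat (f (x, u)) ≤ t (f (x, u)) := le_max_right _ _
        have h5 : t x ≤ ghat := max_le hghat.le hx
        have h6 : 0 ≤ t x - t (f (x, u)) := h0
        show hhat (f (x, u)) ≤ ghat
        linarith
      · have h6 : α₃ (d x) ≤ t x - t (f (x, u)) := h3
        show t (f (x, u)) - t x ≤ -α₃ (d x)
        linarith
end

section
/- Let D ⊆ ℝⁿ be a set, U ⊆ ℝᵐ compact and non-empty, f : ℝⁿ × ℝᵐ × ℝᵖ → ℝⁿ continuous, and let h, ĥ : ℝⁿ → ℝ be continuous functions satisfying |ĥ(y) − h(y)| ≤ ε for all y ∈ ℝⁿ, for some ε ≥ 0. Let σ : [0, ∞) → [0, ∞) satisfy |ĥ(f(x, u, w)) − ĥ(f(x, u, 0))| ≤ σ(‖w‖) for all x ∈ D, u ∈ U, w ∈ ℝᵖ. Define Δh(x) := max_{u ∈ U} ( h(x) − h(f(x, u, 0)) ) and Δĥ(x) := max_{u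 ∈ U} ( ĥ(x) − ĥ(f(x, u, 0)) ). Then for every c_Δ ∈ (0, 1], every x ∈ D, every w ∈ ℝᵖ, and every u ∈ U satisfying ĥ(f(x, u, 0)) − ĥ(x) ≤ −c_Δ · Δĥ(x), it holds that h(f(x, u, w)) − h(x) ≤ −c_Δ · Δh(x) + 4ε + σ(‖w‖). -/
/-- Key ISS decrease estimate: if `hhat` approximates `h` within `ε`, the disturbance
influence on `hhat ∘ f` is bounded by `σ ‖w‖`, and the input `u ∈ U` satisfies the
approximate decrease constraint with maximal decrease
`Δhhat x = max_{u ∈ U} (hhat x - hhat (f (x, u, 0)))`, then the true function `h` satisfies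
`h (f (x, u, w)) - h x ≤ -c_Δ · Δh x + 4ε + σ ‖w‖` with
`Δh x = max_{u ∈ U} (h x - h (f (x, u, 0)))`. -/
theorem stmt9 {n m p : ℕ}
    (D : Set (EuclideanSpace ℝ (Fin n)))
    (U : Set (EuclideanSpace ℝ (Fin m))) (hUcomp : IsCompact U) (hUne : U.Nonempty)
    (f : EuclideanSpace ℝ (Fin n) × EuclideanSpace ℝ (Fin m) × EuclideanSpace ℝ (Fin p) →
      EuclideanSpace ℝ (Fin n))
    (hfc : Continuous f)
    (h hhat : EuclideanSpace ℝ (Fin n) → ℝ) (hhc : Continuous h) (hhatc : Continuous hhat)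
    (ε : ℝ) (hε : 0 ≤ ε)
    (herr : ∀ y, |hhat y - h y| ≤ ε)
    (σ : ℝ → ℝ) (hσnonneg : ∀ s, 0 ≤ s → 0 ≤ σ s)
    (hσ : ∀ x ∈ D, ∀ u ∈ U, ∀ w : EuclideanSpace ℝ (Fin p),
      |hhat (f (x, u, w)) - hhat (f (x, u, 0))| ≤ σ ‖w‖) :
    ∀ cΔ ∈ Set.Ioc (0 : ℝ) 1, ∀ x ∈ D, ∀ w : EuclideanSpace ℝ (Fin p), ∀ u ∈ U,
      hhat (f (x, u, 0)) - hhat x ≤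
          -(cΔ * sSup ((fun v => hhat x - hhat (f (x, v, 0))) '' U)) →
      h (f (x, u, w)) - h x ≤
          -(cΔ * sSup ((fun v => h x - h (f (x, v, 0))) '' U)) + 4 * ε + σ ‖w‖ := by
  intro c hc x hx w u hu hdec
  have hb : BddAbove ((fun v => hhat x - hhat (f (x, v, 0))) '' U) := by
    apply hUcomp.bddAbove_image
    apply Continuous.continuousOn
    fun_prop
  have key : sSup ((fun v => h x - h (f (x, v, 0))) '' U) ≤
      sSup ((fun v => hhat x - hhat (f (x, v, 0))) '' U) + 2 * ε := by
    apply csSup_le (hUne.image _)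
    rintro _ ⟨v, hv, rfl⟩
    have h1 := le_csSup hb (Set.mem_image_of_mem _ hv)
    have h2 := abs_le.mp (herr x)
    have h3 := abs_le.mp (herr (f (x, v, 0)))
    simp only at h1 ⊢
    linarith [h2.1, h2.2, h3.1, h3.2]
  have h4 := mul_le_mul_of_nonneg_left key hc.1.le
  have h5 : c * ε ≤ ε := mul_le_of_le_one_left hε hc.2
  have h6 := abs_le.mp (herr x)
  have h7 := abs_le.mp (herr (f (x, u, w)))
  have h8 := abs_le.mp (hσ x hx u hu w)
  rw [mul_add] at h4
  linarith [h6.1, h6.2, h7.1, h7.2, h8.1, h8.2]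
end

section
/- Let S, D ⊆ ℝⁿ be compact, non-empty sets with S ⊆ D and D \ S non-empty, let U ⊆ ℝᵐ be compact and non-empty, let f : ℝⁿ × ℝᵐ → ℝⁿ be continuous, and let h : ℝⁿ → ℝ be continuous with S = { x ∈ ℝⁿ : h(x) ≤ 0 }. Let Δh : ℝⁿ → ℝ be continuous with Δh(x) > 0 for all x ∈ D \ S. Let κ : ℝⁿ → ℝᵐ be a feedback satisfying, for all x ∈ D: κ(x) ∈ U; f(x, κ(x)) ∈ D; if x ∈ D \ S then h(f(x, κ(x))) − h(x) ≤ −Δh(x); and if x ∈ S then h(f(x, κ(x))) ≤ 0. Consider the closed-loop trajectories x(k+1) = f(x(k), κ(x(k))) with x(0) ∈ D. Then: (1) S is forward invariant, i.e., x ∈ S implies f(x, κ(x)) ∈ S; and (2) S is asymptotically stable in D, i.e., (a) for every ε > 0 there exists δ > 0 such that x(0) ∈ D and ‖x(0)‖_S < δ imply ‖x(k)‖_S < ε for all k ≥ 0, and (b) there exists δ̄ > 0 such that x(0) ∈ D and ‖x(0)‖_S < δ̄ imply ‖x(k)‖_S → 0 as k → ∞. -/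
open Filter

/-- If `h` is a continuity-based discrete-time CBF with safe set `S = {x : h x ≤ 0}`,
domain `D` and decrease `Δh`, and the feedback `κ` selects safe inputs on `D` with `D`
forward invariant, then `S` is forward invariant and asymptotically stable in `D` for
the closed-loop system `x(k+1) = f (x(k), κ (x(k)))`. -/
theorem stmt15 {n m : ℕ}
    (S D : Set (EuclideanSpace ℝ (Fin n)))
    (hScomp : IsCompact S) (hSne : S.Nonempty)
    (hDcomp : IsCompact D) (hDne : D.Nonempty)
    (hSD : S ⊆ D) (hDSne : (D \ S).Nonempty)
    (U : Set (EuclideanSpace ℝ (Fin m))) (hUcomp : IsCompact U) (hUne : U.Nonempty)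
    (f : EuclideanSpace ℝ (Fin n) × EuclideanSpace ℝ (Fin m) → EuclideanSpace ℝ (Fin n))
    (hfc : Continuous f)
    (h : EuclideanSpace ℝ (Fin n) → ℝ) (hhc : Continuous h)
    (hSdef : S = {x | h x ≤ 0})
    (Δh : EuclideanSpace ℝ (Fin n) → ℝ) (hΔc : Continuous Δh)
    (hΔpos : ∀ x ∈ D \ S, 0 < Δh x)
    (κ : EuclideanSpace ℝ (Fin n) → EuclideanSpace ℝ (Fin m))
    (hκU : ∀ x ∈ D, κ x ∈ U)
    (hκD : ∀ x ∈ D, f (x, κ x) ∈ D)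
    (hκdec : ∀ x ∈ D \ S, h (f (x, κ x)) - h x ≤ -Δh x)
    (hκS : ∀ x ∈ S, h (f (x, κ x)) ≤ 0) :
    (∀ x ∈ S, f (x, κ x) ∈ S) ∧
    (∀ ε > 0, ∃ δ > 0, ∀ x : ℕ → EuclideanSpace ℝ (Fin n),
      x 0 ∈ D → (∀ k, x (k + 1) = f (x k, κ (x k))) →
      Metric.infDist (x 0) S < δ → ∀ k, Metric.infDist (x k) S < ε) ∧
    (∃ δbar > 0, ∀ x : ℕ → EuclideanSpace ℝ (Fin n),
      x 0 ∈ D → (∀ k, x (k + 1) = f (x k, κ (x k))) →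
      Metric.infDist (x 0) S < δbar →
      Tendsto (fun k => Metric.infDist (x k) S) atTop (nhds 0)) := by
  have memS : ∀ x, x ∈ S ↔ h x ≤ 0 := fun x => by rw [hSdef]; rfl
  have hA : ∀ ε > 0, ∃ c > 0, ∀ x ∈ D, h x < c → Metric.infDist x S < ε := by
    intro ε hε
    have hK : IsCompact (D ∩ {x | ε ≤ Metric.infDist x S}) :=
      hDcomp.inter_right (isClosed_le continuous_const (Metric.continuous_infDist_pt S))
    obtain ⟨c, hc, hcK⟩ := hK.exists_forall_le' (f := h) (a := 0) hhc.continuousOn (by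
      rintro b ⟨_, hb⟩
      by_contra hn
      have hb0 := Metric.infDist_zero_of_mem ((memS b).2 (not_lt.1 hn))
      have hb' : ε ≤ Metric.infDist b S := hb
      linarith)
    refine ⟨c, hc, fun x hx hxc => ?_⟩
    by_contra hn
    exact absurd (hcK x ⟨hx, not_lt.1 hn⟩) (not_le.2 hxc)
  have hinD : ∀ x : ℕ → EuclideanSpace ℝ (Fin n),
      x 0 ∈ D → (∀ k, x (k + 1) = f (x k, κ (x k))) → ∀ k, x k ∈ D := by
    intro x h0 hs k
    induction k with
    | zero => exact h0
    | succ k ih => rw [hs]; exact hκD _ ih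
  have hstep : ∀ c > 0, ∀ x ∈ D, h x < c → h (f (x, κ x)) < c := by
    intro c hc x hx hxc
    by_cases hxS : x ∈ S
    · exact (hκS x hxS).trans_lt hc
    · have h1 := hκdec x ⟨hx, hxS⟩
      have h2 := hΔpos x ⟨hx, hxS⟩
      linarith
  refine ⟨fun x hx => (memS _).2 (hκS x hx), ?_, 1, one_pos, ?_⟩
  · intro ε hε
    obtain ⟨c, hc, hcA⟩ := hA ε hε
    obtain ⟨δ, hδ, hsub⟩ := hScomp.exists_thickening_subset_open
      (isOpen_lt hhc continuous_const : IsOpen {x | h x < c})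
      (fun x hx => ((memS x).1 hx).trans_lt hc)
    refine ⟨δ, hδ, fun x h0 hs hd k => ?_⟩
    have hD := hinD x h0 hs
    refine hcA _ (hD k) ?_
    induction k with
    | zero =>
      apply hsub
      rw [Metric.mem_thickening_iff]
      exact (Metric.infDist_lt_iff hSne).1 hd
    | succ k ih => rw [hs]; exact hstep c hc _ (hD k) ih
  · intro x h0 hs _
    have hD := hinD x h0 hs
    rw [Metric.tendsto_atTop]
    intro ε hε
    obtain ⟨c, hc, hcA⟩ := hA ε hε
    have hex : ∃ N, h (x N) < c := by
      by_contra! hn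
      have hK : IsCompact (D ∩ {x | c ≤ h x}) :=
        hDcomp.inter_right (isClosed_le continuous_const hhc)
      have hnS : ∀ y, c ≤ h y → y ∉ S := fun y hy hyS => by
        have := (memS y).1 hyS
        linarith
      obtain ⟨d, hd, hdK⟩ := hK.exists_forall_le' (f := Δh) (a := 0) hΔc.continuousOn
        (fun b hb => hΔpos b ⟨hb.1, hnS b hb.2⟩)
      have hlin : ∀ k : ℕ, h (x k) ≤ h (x 0) - k * d := by
        intro k
        induction k with
        | zero => simp
        | succ k ih =>
          have h1 := hκdec (x k) ⟨hD k, hnS _ (hn k)⟩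
          have h2 := hdK (x k) ⟨hD k, hn k⟩
          rw [hs]
          push_cast
          linarith
      obtain ⟨k, hk⟩ := exists_nat_gt (h (x 0) / d)
      rw [div_lt_iff₀ hd] at hk
      have := hlin k
      have := hn k
      linarith
    obtain ⟨N, hN⟩ := hex
    refine ⟨N, fun k hk => ?_⟩
    have : h (x k) < c := by
      induction k, hk using Nat.le_induction with
      | base => exact hN
      | succ k _ ih => rw [hs]; exact hstep c hc _ (hD k) ih
    rw [Real.dist_eq, sub_zero, abs_of_nonneg Metric.infDist_nonneg]
    exact hcA _ (hD k) this
end
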